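/- The symmetric group S7 contains two maximal subgroups of order 42 whose intersection is trivial, hence ι(S7) = 2. -/

import Mathlib

/-- The intersection number of a group: the minimum number of maximal subgroups
whose intersection equals the Frattini subgroup. -/
noncomputable def interNum (G : Type*) [Group G] : ℕ :=
  sInf {n | ∃ s : Finset (Subgroup G), s.card = n ∧ (∀ M ∈ s, IsCoatom M) ∧
    s.inf id = frattini G}

/-- The group of affine permutations `x ↦ s * x + t`, `s ≠ 0`, of a field. -/
def affineSubgroup (F : Type*) [Field F] : Subgroup (Equiv.Perm F) where
  carrier := {σ | ∃ s t : F, s ≠ 0 ∧ ∀ x, σ x = s * x + t}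
  mul_mem' := by
    rintro σ τ ⟨s, t, hs, hσ⟩ ⟨u, v, hu, hτ⟩
    exact ⟨s * u, s * v + t, mul_ne_zero hs hu, fun x => by
      rw [Equiv.Perm.mul_apply, hσ, hτ]; ring⟩
  one_mem' := ⟨1, 0, one_ne_zero, fun x => by simp⟩
  inv_mem' := by
    rintro σ ⟨s, t, hs, hσ⟩
    refine ⟨s⁻¹, -(s⁻¹ * t), inv_ne_zero hs, fun x => ?_⟩
    rw [Equiv.Perm.inv_eq_iff_eq, hσ]
    field_simp
    ring

section Affine

variable {F : Type*} [Field F]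

/-- The permutation `x ↦ s * x + t` of a field. -/
def affinePerm (s : Fˣ) (t : F) : Equiv.Perm F :=
  (Equiv.mulLeft₀ (s : F) s.ne_zero).trans (Equiv.addRight t)

@[simp]
theorem affinePerm_apply (s : Fˣ) (t x : F) : affinePerm s t x = s * x + t :=
  rfl

theorem affinePerm_mem (s : Fˣ) (t : F) : affinePerm s t ∈ affineSubgroup F :=
  ⟨s, t, s.ne_zero, fun _ => rfl⟩

theorem card_affineSubgroup : Nat.card (affineSubgroup F) = Nat.card Fˣ * Nat.card F := by
  rw [← Nat.card_prod]
  symm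
  refine Nat.card_congr (Equiv.ofBijective
    (fun p : Fˣ × F => (⟨affinePerm p.1 p.2, affinePerm_mem p.1 p.2⟩ : affineSubgroup F)) ⟨?_, ?_⟩)
  · rintro ⟨s, t⟩ ⟨u, v⟩ h
    have h' : ∀ x : F, s * x + t = u * x + v := fun x =>
      DFunLike.congr_fun (congrArg Subtype.val h) x
    have h₀ : t = v := by simpa using h' 0
    have h₁ := h' 1
    subst h₀
    simpa [Units.ext_iff] using h₁
  · rintro ⟨σ, s, t, hs, hσ⟩
    exact ⟨(Units.mk0 s hs, t), Subtype.ext (Equiv.ext fun x => (hσ x).symm)⟩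

end Affine

instance : Fact (Nat.Prime 7) := ⟨by norm_num⟩

theorem card_affineSubgroup_zmod_seven : Nat.card (affineSubgroup (ZMod 7)) = 42 := by
  rw [card_affineSubgroup, Nat.card_eq_fintype_card, ZMod.card_units, Nat.card_zmod]

set_option synthInstance.maxSize 1000 in
/-- Here `![0, 1, a, b, c, d, e]` runs through the nontrivial permutations of `ZMod 7` that fix
`0` and `1`. The listed pairs `(s, t)` are a small set of affine maps that suffices. -/
theorem exists_card_iterate_ne_eq_two :
    ∀ a : ZMod 7, a ∉ [0, 1] → ∀ b, b ∉ [0, 1, a] → ∀ c, c ∉ [0, 1, a, b] →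
    ∀ d, d ∉ [0, 1, a, b, c] → ∀ e, e ∉ [0, 1, a, b, c, d] → [a, b, c, d, e] ≠ [2, 3, 4, 5, 6] →
    ∃ p ∈ ([(6, 1), (1, 0), (4, 2), (2, 3), (6, 5), (6, 2), (5, 5), (4, 3), (2, 1)] :
      List (ZMod 7 × ZMod 7)), p.1 ≠ 0 ∧ (Finset.univ.filter fun x : ZMod 7 =>
        (fun y : ZMod 7 => (![0, 1, a, b, c, d, e] : Fin 7 → ZMod 7) (p.1 * y + p.2))^[15] x
          ≠ x).card = 2 := by
  decide +kernel

theorem exists_isSwap_pow_mul_affine {f : Equiv.Perm (ZMod 7)} (h₀ : f 0 = 0) (h₁ : f 1 = 1)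
    (hf : f ≠ 1) : ∃ m ∈ affineSubgroup (ZMod 7), ((f * m) ^ 15).IsSwap := by
  have key : ∀ x : ZMod 7, f x = (![0, 1, f 2, f 3, f 4, f 5, f 6] : Fin 7 → ZMod 7) x := by
    intro x
    change Fin 7 at x
    fin_cases x
    exacts [h₀, h₁, rfl, rfl, rfl, rfl, rfl]
  have hinj : ∀ x y : ZMod 7, x ≠ y → f x ≠ f y := fun x y => f.injective.ne
  have hne : ∀ x : ZMod 7, x ≠ 0 → f x ≠ 0 := fun x hx => h₀ ▸ hinj x 0 hx
  have hne' : ∀ x : ZMod 7, x ≠ 1 → f x ≠ 1 := fun x hx h => hinj x 1 hx (h.trans h₁.symm)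
  obtain ⟨p, -, hp, hcard⟩ := exists_card_iterate_ne_eq_two (f 2)
    (by simp only [List.mem_cons, List.not_mem_nil, not_or]
        refine ⟨hne _ ?_, hne' _ ?_, not_false⟩ <;> decide) (f 3)
    (by simp only [List.mem_cons, List.not_mem_nil, not_or]
        refine ⟨hne _ ?_, hne' _ ?_, hinj _ _ ?_, not_false⟩ <;> decide) (f 4)
    (by simp only [List.mem_cons, List.not_mem_nil, not_or]
        refine ⟨hne _ ?_, hne' _ ?_, hinj _ _ ?_, hinj _ _ ?_, not_false⟩ <;> decide) (f 5)
    (by simp only [List.mem_cons, List.not_mem_nil, not_or]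
        refine ⟨hne _ ?_, hne' _ ?_, hinj _ _ ?_, hinj _ _ ?_, hinj _ _ ?_, not_false⟩ <;>
          decide) (f 6)
    (by simp only [List.mem_cons, List.not_mem_nil, not_or]
        refine ⟨hne _ ?_, hne' _ ?_, hinj _ _ ?_, hinj _ _ ?_, hinj _ _ ?_, hinj _ _ ?_,
          not_false⟩ <;> decide)
    (by
      intro h
      simp only [List.cons.injEq, and_true] at h
      obtain ⟨h2, h3, h4, h5, h6⟩ := h
      refine hf (Equiv.ext fun x => ?_)
      change Fin 7 at x
      fin_cases x
      exacts [h₀, h₁, h2, h3, h4, h5, h6])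
  refine ⟨affinePerm (Units.mk0 p.1 hp) p.2, affinePerm_mem _ _, ?_⟩
  rw [← Equiv.Perm.card_support_eq_two, ← hcard]
  congr 1
  ext x
  have hcoe : ⇑(f * affinePerm (Units.mk0 p.1 hp) p.2) = fun y : ZMod 7 =>
      (![0, 1, f 2, f 3, f 4, f 5, f 6] : Fin 7 → ZMod 7) (p.1 * y + p.2) :=
    funext fun y => key _
  rw [Equiv.Perm.mem_support, Finset.mem_filter, Equiv.Perm.coe_pow, hcoe]
  simp

theorem isCoatom_affineSubgroup_zmod_seven : IsCoatom (affineSubgroup (ZMod 7)) := by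
  classical
  constructor
  · intro h
    have hc := card_affineSubgroup_zmod_seven
    rw [h, Subgroup.card_top, Nat.card_perm, Nat.card_zmod] at hc
    exact absurd hc (by decide)
  · intro K hK
    obtain ⟨hle, g, hgK, hg⟩ := SetLike.lt_iff_le_and_exists.mp hK
    have hs : g 1 - g 0 ≠ 0 := sub_ne_zero.mpr (g.injective.ne one_ne_zero)
    set m := affinePerm (Units.mk0 _ hs) (g 0) with hm
    have hmM : m ∈ affineSubgroup (ZMod 7) := affinePerm_mem _ _
    obtain ⟨n, hn, hswap⟩ := exists_isSwap_pow_mul_affine (f := m⁻¹ * g)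
      (by rw [Equiv.Perm.mul_apply, Equiv.Perm.inv_eq_iff_eq]; simp [hm])
      (by rw [Equiv.Perm.mul_apply, Equiv.Perm.inv_eq_iff_eq]; simp [hm])
      (fun h => hg (inv_mul_eq_one.mp h ▸ hmM))
    refine Equiv.Perm.subgroup_eq_top_of_swap_mem (by rw [ZMod.card]; norm_num) ?_
      (pow_mem (mul_mem (mul_mem (inv_mem (hle hmM)) hgK) (hle hn)) 15) hswap
    rw [ZMod.card, ← Nat.card_eq_fintype_card]
    refine dvd_trans ?_ (Subgroup.card_dvd_of_le hle)
    rw [card_affineSubgroup_zmod_seven]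
    norm_num

theorem affineSubgroup_inf_map_conj_eq_bot : ∃ τ : Equiv.Perm (ZMod 7),
    affineSubgroup (ZMod 7) ⊓ (affineSubgroup (ZMod 7)).map (MulAut.conj τ).toMonoidHom = ⊥ := by
  let τ : Equiv.Perm (ZMod 7) := Equiv.swap 4 5 * Equiv.swap 5 6
  have key : ∀ s t : ZMod 7, (∃ u v : ZMod 7, ∀ x, τ (s * x + t) = u * τ x + v) → s ≠ 0 →
      s = 1 ∧ t = 0 := by
    decide +kernel
  refine ⟨τ, (Subgroup.eq_bot_iff_forall _).mpr ?_⟩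
  rintro _ ⟨⟨u, v, -, hσ⟩, ρ, ⟨s, t, hs, hρ⟩, rfl⟩
  obtain ⟨rfl, rfl⟩ := key s t ⟨u, v, fun x => by simpa [hρ] using hσ (τ x)⟩ hs
  have : ρ = 1 := Equiv.ext fun x => by simp [hρ]
  simp [this]

/-- A group in which two maximal subgroups meet trivially has intersection number two, unless
its trivial subgroup is maximal. -/
theorem interNum_eq_two {G : Type*} [Group G] {M₁ M₂ : Subgroup G} (h₁ : IsCoatom M₁)
    (h₂ : IsCoatom M₂) (h : M₁ ⊓ M₂ = ⊥) (hbot : ¬IsCoatom (⊥ : Subgroup G)) :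
    interNum G = 2 := by
  classical
  have hfrat : frattini G = ⊥ :=
    le_bot_iff.mp (h ▸ le_inf (frattini_le_coatom h₁) (frattini_le_coatom h₂))
  have hne : M₁ ≠ M₂ := by
    rintro rfl
    exact hbot (by rwa [← h, inf_idem])
  have hmem : 2 ∈ {n | ∃ s : Finset (Subgroup G), s.card = n ∧ (∀ M ∈ s, IsCoatom M) ∧
      s.inf id = frattini G} :=
    ⟨{M₁, M₂}, Finset.card_pair hne, by simp [h₁, h₂], by simp [hfrat, h]⟩
  refine le_antisymm (Nat.sInf_le hmem) (le_csInf ⟨2, hmem⟩ ?_)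
  rintro n ⟨s, rfl, hs, hinf⟩
  rw [hfrat] at hinf
  by_contra! hlt
  obtain hcard | hcard : s.card = 0 ∨ s.card = 1 := by omega
  · rw [Finset.card_eq_zero] at hcard
    subst hcard
    exact h₁.1 (top_le_iff.mp ((Finset.inf_empty.symm.trans hinf).trans_le bot_le))
  · obtain ⟨M, rfl⟩ := Finset.card_eq_one.mp hcard
    rw [Finset.inf_singleton, id] at hinf
    exact hbot (hinf ▸ hs M (Finset.mem_singleton_self M))

theorem S7_interNum :
    (∃ M₁ M₂ : Subgroup (Equiv.Perm (Fin 7)), IsCoatom M₁ ∧ IsCoatom M₂ ∧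
      Nat.card M₁ = 42 ∧ Nat.card M₂ = 42 ∧ M₁ ⊓ M₂ = ⊥) ∧
    interNum (Equiv.Perm (Fin 7)) = 2 := by
  obtain ⟨τ, hτ⟩ := affineSubgroup_inf_map_conj_eq_bot
  have hM := isCoatom_affineSubgroup_zmod_seven
  have hcard := card_affineSubgroup_zmod_seven
  have hM' : IsCoatom ((affineSubgroup (ZMod 7)).map (MulAut.conj τ).toMonoidHom) :=
    ((MulAut.conj τ).mapSubgroup.isCoatom_iff _).mpr hM
  have hcard' : Nat.card ((affineSubgroup (ZMod 7)).map (MulAut.conj τ).toMonoidHom) = 42 :=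
    (Subgroup.card_map_of_injective (MulAut.conj τ).injective).trans hcard
  refine ⟨⟨_, _, hM, hM', hcard, hcard', hτ⟩, interNum_eq_two hM hM' hτ fun hbot => ?_⟩
  have hbot' : affineSubgroup (ZMod 7) ≠ ⊥ := fun h => by
    rw [h, Subgroup.card_bot] at hcard
    exact absurd hcard (by norm_num)
  exact hM.1 (hbot.2 _ (bot_lt_iff_ne_bot.mpr hbot'))
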